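/- arXiv:math/0605427 — 3 statements merged into one kernel-verified Lean document; each statement's English description precedes it below -/
import Mathlib

section
/- Let n ≥ 2, 0 < s < n, and 0 < λ < 1. The subset S = {z ∈ ℂⁿ : z_1 = ⋯ = z_s = 0, z ≠ 0} of U₊ = {z ∈ ℂⁿ : b_{s,n}(z,z) > 0} is invariant under multiplication by λ, the inclusion S ↪ U₊ is equivariant for the G_λ-actions, and the induced continuous map of quotient spaces S/G_λ → U₊/G_λ = Ω₊ is a homotopy equivalence; that is, the complex Hopf manifold ℂH^{n-s}(λ) = (ℂ^{n-s} \ {0})/G_λ is homotopy equivalent to Ω₊ (indeed it embeds as a strong deformation retract of Ω₊). -/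
/-- The indefinite quadratic form `b_{s,n}(z,z)`. -/
noncomputable def bq (n s : ℕ) (z : Fin n → ℂ) : ℝ :=
  ∑ j : Fin n, (if (j : ℕ) < s then (-1 : ℝ) else 1) * Complex.normSq (z j)

/-- The subset `S = {z : z_1 = ⋯ = z_s = 0, z ≠ 0}` of `ℂⁿ`, as a predicate. -/
def predS (n s : ℕ) (z : Fin n → ℂ) : Prop :=
  (∀ j : Fin n, (j : ℕ) < s → z j = 0) ∧ z ≠ 0

/-- The `G_λ`-orbit relation on a subset of `ℂᵏ` given by a predicate `P`. -/
def orbRelP (k : ℕ) (lam : ℝ) (P : (Fin k → ℂ) → Prop)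
    (z z' : {z : Fin k → ℂ // P z}) : Prop :=
  ∃ m : ℤ, (z' : Fin k → ℂ) = (lam ^ m : ℝ) • (z : Fin k → ℂ)

open scoped unitInterval

/-- A strong deformation retraction compatible with relations induces a
homotopy equivalence of the quotient spaces. -/
theorem exists_quot_homotopyEquiv {X Y : Type*} [TopologicalSpace X] [TopologicalSpace Y]
    {r : X → X → Prop} {q : Y → Y → Prop} (f : C(X, Y)) (g : C(Y, X)) (H : C(Y × I, Y))
    (hf : ∀ x x', r x x' → q (f x) (f x')) (hg : ∀ y y', q y y' → r (g y) (g y'))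
    (hH : ∀ t y y', q y y' → q (H (y, t)) (H (y', t)))
    (hgf : ∀ x, g (f x) = x) (h0 : ∀ y, H (y, 0) = f (g y)) (h1 : ∀ y, H (y, 1) = y) :
    ∃ he : ContinuousMap.HomotopyEquiv (Quot r) (Quot q),
      ∀ x, he.toFun (Quot.mk r x) = Quot.mk q (f x) := by
  let mk : C(Y, Quot q) := ⟨Quot.mk q, continuous_quot_mk⟩
  let F : C(Quot r, Quot q) :=
    ⟨Quot.map f hf, continuous_quot_lift _ (continuous_quot_mk.comp f.continuous)⟩
  let G : C(Quot q, Quot r) :=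
    ⟨Quot.map g hg, continuous_quot_lift _ (continuous_quot_mk.comp g.continuous)⟩
  let K : C(Quot q, C(I, Quot q)) :=
    ⟨Quot.lift (mk.comp H).curry fun y y' h => ContinuousMap.ext fun t =>
      Quot.sound (hH t y y' h), continuous_quot_lift _ (mk.comp H).curry.continuous⟩
  have hFG : (F.comp G).Homotopy (ContinuousMap.id (Quot q)) :=
    { toContinuousMap := K.uncurry.comp ContinuousMap.prodSwap
      map_zero_left := by
        rintro ⟨y⟩
        exact congrArg (Quot.mk q) (h0 y)
      map_one_left := by
        rintro ⟨y⟩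
        exact congrArg (Quot.mk q) (h1 y) }
  have hGF : G.comp F = ContinuousMap.id (Quot r) := by
    ext ⟨x⟩
    exact congrArg (Quot.mk r) (hgf x)
  exact ⟨⟨F, G, hGF ▸ ContinuousMap.Homotopic.refl _, ⟨hFG⟩⟩, fun _ => rfl⟩

/-- Multiplication of the first `s` coordinates by `t`. -/
noncomputable def scaleFirst (n s : ℕ) (t : ℝ) (z : Fin n → ℂ) : Fin n → ℂ :=
  fun j => if (j : ℕ) < s then t • z j else z j

theorem scaleFirst_smul (n s : ℕ) (t c : ℝ) (z : Fin n → ℂ) :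
    scaleFirst n s t (c • z) = c • scaleFirst n s t z := by
  ext j
  simp only [scaleFirst, Pi.smul_apply]
  split_ifs
  · exact smul_comm t c (z j)
  · rfl

theorem scaleFirst_one (n s : ℕ) (z : Fin n → ℂ) : scaleFirst n s 1 z = z := by
  ext j
  simp [scaleFirst]

theorem continuous_scaleFirst (n s : ℕ) :
    Continuous fun p : (Fin n → ℂ) × ℝ => scaleFirst n s p.2 p.1 := by
  refine continuous_pi fun j => ?_
  by_cases h : (j : ℕ) < s <;> simp only [scaleFirst, h, if_true, if_false] <;> fun_prop

theorem bq_le_bq_scaleFirst (n s : ℕ) {t : ℝ} (h0 : 0 ≤ t) (h1 : t ≤ 1) (z : Fin n → ℂ) :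
    bq n s z ≤ bq n s (scaleFirst n s t z) := by
  refine Finset.sum_le_sum fun j _ => ?_
  by_cases h : (j : ℕ) < s
  · simp only [scaleFirst, h, if_true, Complex.real_smul, Complex.normSq_mul,
      Complex.normSq_ofReal]
    nlinarith [Complex.normSq_nonneg (z j), mul_nonneg (sub_nonneg.2 h1) (add_nonneg h0 zero_le_one),
      mul_nonneg (Complex.normSq_nonneg (z j))
        (sub_nonneg.2 (mul_le_one₀ h1 h0 h1))]
  · simp [scaleFirst, h]

theorem exists_ne_zero_of_bq_pos {n s : ℕ} {z : Fin n → ℂ} (hz : 0 < bq n s z) :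
    ∃ j : Fin n, s ≤ (j : ℕ) ∧ z j ≠ 0 := by
  by_contra! h
  refine hz.not_ge (Finset.sum_nonpos fun j _ => ?_)
  by_cases hj : (j : ℕ) < s
  · simp [hj, Complex.normSq_nonneg]
  · simp [h j (not_lt.1 hj)]

theorem bq_pos_of_predS {n s : ℕ} {z : Fin n → ℂ} (hz : predS n s z) : 0 < bq n s z := by
  obtain ⟨j, hj⟩ := Function.ne_iff.1 hz.2
  have hjs : ¬ (j : ℕ) < s := fun h => hj (hz.1 j h)
  refine Finset.sum_pos' (fun i _ => ?_) ⟨j, Finset.mem_univ j, ?_⟩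
  · by_cases hi : (i : ℕ) < s
    · simp [hz.1 i hi]
    · simp [hi, Complex.normSq_nonneg]
  · simpa [hjs] using hj

theorem predS_smul {n s : ℕ} {z : Fin n → ℂ} (hz : predS n s z) {c : ℝ} (hc : c ≠ 0) :
    predS n s (c • z) :=
  ⟨fun j hj => by simp [hz.1 j hj], smul_ne_zero hc hz.2⟩

theorem predS_scaleFirst_zero {n s : ℕ} {z : Fin n → ℂ} (hz : 0 < bq n s z) :
    predS n s (scaleFirst n s 0 z) := by
  obtain ⟨j, hj, hzj⟩ := exists_ne_zero_of_bq_pos hz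
  exact ⟨fun i hi => by simp [scaleFirst, hi],
    Function.ne_iff.2 ⟨j, by simpa [scaleFirst, hj.not_gt] using hzj⟩⟩

theorem scaleFirst_zero_of_predS {n s : ℕ} {z : Fin n → ℂ} (hz : predS n s z) :
    scaleFirst n s 0 z = z := by
  ext j
  by_cases hj : (j : ℕ) < s
  · simp [scaleFirst, hj, hz.1 j hj]
  · simp [scaleFirst, hj]

/-- Homogeneous maps `f`, `g` with `g ∘ f = id` and `f ∘ g` the projection killing the first `s`
coordinates induce a homotopy equivalence onto `Ω₊`. -/
theorem exists_homotopyEquiv_bq_pos (n s k : ℕ) (lam : ℝ) (P : (Fin k → ℂ) → Prop)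
    (f : (Fin k → ℂ) → Fin n → ℂ) (g : (Fin n → ℂ) → Fin k → ℂ)
    (hfc : Continuous f) (hgc : Continuous g)
    (hfs : ∀ (c : ℝ) w, f (c • w) = c • f w) (hgs : ∀ (c : ℝ) z, g (c • z) = c • g z)
    (hfP : ∀ w, P w → 0 < bq n s (f w)) (hgP : ∀ z, 0 < bq n s z → P (g z))
    (hgf : ∀ w, P w → g (f w) = w) (hfg : ∀ z, scaleFirst n s 0 z = f (g z)) :
    ∃ he : ContinuousMap.HomotopyEquiv (Quot (orbRelP k lam P))
        (Quot (orbRelP n lam (fun z => 0 < bq n s z))),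
      ∀ w : {w // P w}, he.toFun (Quot.mk _ w) = Quot.mk _ ⟨f w, hfP w w.2⟩ := by
  let H : C({z : Fin n → ℂ // 0 < bq n s z} × I, {z : Fin n → ℂ // 0 < bq n s z}) :=
    ⟨fun p => ⟨scaleFirst n s p.2 p.1,
      p.1.2.trans_le (bq_le_bq_scaleFirst n s p.2.2.1 p.2.2.2 p.1)⟩,
      ((continuous_scaleFirst n s).comp (by fun_prop :
        Continuous fun p : {z : Fin n → ℂ // 0 < bq n s z} × I =>
          ((p.1 : Fin n → ℂ), (p.2 : ℝ)))).subtype_mk _⟩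
  refine exists_quot_homotopyEquiv
    ⟨fun w => ⟨f w, hfP w w.2⟩, (hfc.comp continuous_subtype_val).subtype_mk _⟩
    ⟨fun z => ⟨g z, hgP z z.2⟩, (hgc.comp continuous_subtype_val).subtype_mk _⟩ H
    ?_ ?_ ?_ (fun w => Subtype.ext (hgf w w.2)) (fun z => Subtype.ext (hfg z))
    (fun z => Subtype.ext (scaleFirst_one n s z))
  · rintro w w' ⟨m, h⟩
    exact ⟨m, (congrArg f h).trans (hfs _ _)⟩
  · rintro z z' ⟨m, h⟩
    exact ⟨m, (congrArg g h).trans (hgs _ _)⟩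
  · rintro t z z' ⟨m, h⟩
    exact ⟨m, (congrArg (scaleFirst n s t) h).trans (scaleFirst_smul _ _ _ _ _)⟩

/-- The embedding of `ℂ^{n-s}` into `ℂⁿ` as the last `n - s` coordinates. -/
noncomputable def extendLast (n s : ℕ) (w : Fin (n - s) → ℂ) : Fin n → ℂ :=
  fun j => if h : s ≤ (j : ℕ) then w ⟨j - s, Nat.sub_lt_sub_right h j.2⟩ else 0

/-- The projection of `ℂⁿ` onto the last `n - s` coordinates. -/
def restrictLast (n s : ℕ) (z : Fin n → ℂ) : Fin (n - s) → ℂ :=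
  fun i => z ⟨i + s, Nat.add_lt_of_lt_sub i.2⟩

theorem restrictLast_extendLast (n s : ℕ) (w : Fin (n - s) → ℂ) :
    restrictLast n s (extendLast n s w) = w := by
  ext i
  simp [restrictLast, extendLast]

theorem extendLast_restrictLast (n s : ℕ) (z : Fin n → ℂ) :
    extendLast n s (restrictLast n s z) = scaleFirst n s 0 z := by
  ext j
  by_cases h : s ≤ (j : ℕ)
  · simp [restrictLast, extendLast, scaleFirst, h, h.not_gt]
  · simp [extendLast, scaleFirst, h, not_le.1 h]

theorem continuous_extendLast (n s : ℕ) : Continuous (extendLast n s) := by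
  refine continuous_pi fun j => ?_
  by_cases h : s ≤ (j : ℕ) <;> simp only [extendLast, h, dite_true, dite_false] <;> fun_prop

theorem extendLast_smul (n s : ℕ) (c : ℝ) (w : Fin (n - s) → ℂ) :
    extendLast n s (c • w) = c • extendLast n s w := by
  ext j
  by_cases h : s ≤ (j : ℕ) <;> simp [extendLast, h]

theorem predS_extendLast {n s : ℕ} {w : Fin (n - s) → ℂ} (hw : w ≠ 0) :
    predS n s (extendLast n s w) := by
  refine ⟨fun j hj => by simp [extendLast, hj.not_ge], fun h => hw ?_⟩
  rw [← restrictLast_extendLast n s w, h]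
  rfl

theorem restrictLast_ne_zero {n s : ℕ} {z : Fin n → ℂ} (hz : 0 < bq n s z) :
    restrictLast n s z ≠ 0 := by
  intro h
  apply (predS_scaleFirst_zero hz).2
  rw [← extendLast_restrictLast, h]
  ext j
  simp [extendLast]

/-- the subset `S = {z : z₁ = ⋯ = z_s = 0, z ≠ 0}` of
`U₊ = {b_{s,n}(z,z) > 0}` is `G_λ`-invariant, the inclusion `S ↪ U₊` is equivariant, and
the induced continuous map `S/G_λ → U₊/G_λ = Ω₊` is a homotopy equivalence; i.e. the
complex Hopf manifold `ℂH^{n-s}(λ) = (ℂ^{n-s} \ {0})/G_λ` is homotopy equivalent to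
`Ω₊`. -/
theorem stmt_11 (n s : ℕ) (hn : 2 ≤ n) (hs : 0 < s) (hsn : s < n)
    (lam : ℝ) (hlam0 : 0 < lam) (hlam1 : lam < 1) :
    (∀ z : Fin n → ℂ, predS n s z → ∀ m : ℤ, predS n s ((lam ^ m : ℝ) • z)) ∧
    (∀ z : Fin n → ℂ, predS n s z → 0 < bq n s z) ∧
    (∃ he : ContinuousMap.HomotopyEquiv
        (Quot (orbRelP n lam (predS n s)))
        (Quot (orbRelP n lam (fun z => 0 < bq n s z))),
      ∀ (z : {z : Fin n → ℂ // predS n s z}) (hz : 0 < bq n s (z : Fin n → ℂ)),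
        he.toFun (Quot.mk _ z) = Quot.mk _ ⟨(z : Fin n → ℂ), hz⟩) ∧
    Nonempty (ContinuousMap.HomotopyEquiv
      (Quot (orbRelP (n - s) lam (fun z => z ≠ 0)))
      (Quot (orbRelP n lam (fun z => 0 < bq n s z)))) := by
  refine ⟨fun z hz m => predS_smul hz (zpow_ne_zero m hlam0.ne'), fun z => bq_pos_of_predS,
    ?_, ?_⟩
  · obtain ⟨he, h⟩ := exists_homotopyEquiv_bq_pos n s n lam (predS n s) id (scaleFirst n s 0)
      continuous_id ((continuous_scaleFirst n s).comp (Continuous.prodMk_left 0))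
      (fun _ _ => rfl) (scaleFirst_smul n s 0) (fun _ => bq_pos_of_predS)
      (fun _ => predS_scaleFirst_zero) (fun _ => scaleFirst_zero_of_predS) (fun _ => rfl)
    exact ⟨he, fun z _ => h z⟩
  · obtain ⟨he, -⟩ := exists_homotopyEquiv_bq_pos n s (n - s) lam (fun z => z ≠ 0)
      (extendLast n s) (restrictLast n s) (continuous_extendLast n s)
      (continuous_pi fun i => continuous_apply _) (extendLast_smul n s) (fun _ _ => rfl)
      (fun _ hw => bq_pos_of_predS (predS_extendLast hw)) (fun _ => restrictLast_ne_zero)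
      (fun w _ => restrictLast_extendLast n s w) (fun z => (extendLast_restrictLast n s z).symm)
    exact ⟨he⟩
end

section
/- Let n ≥ 2, 0 < s < n, and r > 0; set ε_j = -1 for 1 ≤ j ≤ s and ε_j = +1 for s+1 ≤ j ≤ n (so ε_n = 1). Define the Cayley transform C(z) = (z_1/(r+z_n), …, z_{n-1}/(r+z_n), i(r−z_n)/(r+z_n)) for z ∈ ℂⁿ with z_n ≠ −r. Then C is a bijection from the punctured pseudosphere {z ∈ ℂⁿ : ∑_{j=1}^n ε_j|z_j|² = r², z_n ≠ −r} onto {ζ ∈ ℂⁿ : Im(ζ_n) = ∑_{α=1}^{n-1} ε_α|ζ_α|², ζ_n ≠ −i}, the boundary of the Siegel-type domain 𝒮_{s,n} = {ζ ∈ ℂⁿ : Im(ζ_n) > ∑_{α=1}^{n-1} ε_α|ζ_α|²} with one point of the fibre ζ_n = −i removed. -/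
/-- The last coordinate index of `Fin n`. -/
def lastIdx (n : ℕ) (hn : 0 < n) : Fin n := ⟨n - 1, by omega⟩

/-- The Cayley transform
`C(z) = (z₁/(r+zₙ), …, z_{n-1}/(r+zₙ), i(r−zₙ)/(r+zₙ))`. -/
noncomputable def cayley (n : ℕ) (hn : 0 < n) (r : ℝ) (z : Fin n → ℂ) : Fin n → ℂ :=
  fun j =>
    if (j : ℕ) < n - 1 then z j / ((r : ℂ) + z (lastIdx n hn))
    else Complex.I * ((r : ℂ) - z (lastIdx n hn)) / ((r : ℂ) + z (lastIdx n hn))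

/-- The signs `ε_j = -1` for `j ≤ s`, `ε_j = +1` for `j > s` (0-indexed: `j < s`). -/
def eps (s : ℕ) {n : ℕ} (j : Fin n) : ℝ := if (j : ℕ) < s then -1 else 1

section Cayley

variable {n : ℕ} {hn : 0 < n} {r : ℝ} {z : Fin n → ℂ}

theorem eq_lastIdx_of_not_lt (hn : 0 < n) {j : Fin n} (hj : ¬ (j : ℕ) < n - 1) :
    j = lastIdx n hn := by
  apply Fin.ext
  simp only [lastIdx]
  omega

theorem cayley_lastIdx :
    cayley n hn r z (lastIdx n hn) =
      Complex.I * ((r : ℂ) - z (lastIdx n hn)) / ((r : ℂ) + z (lastIdx n hn)) := by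
  simp [cayley, lastIdx]

theorem cayley_of_lt {j : Fin n} (hj : (j : ℕ) < n - 1) :
    cayley n hn r z j = z j / ((r : ℂ) + z (lastIdx n hn)) := by
  simp [cayley, hj]

theorem add_ne_zero_of_ne_neg {a b : ℂ} (h : b ≠ -a) : a + b ≠ 0 :=
  fun h' => h (eq_neg_of_add_eq_zero_right h')

/-- The inverse of the Cayley transform. -/
noncomputable def cayleyInv (n : ℕ) (hn : 0 < n) (r : ℝ) (ζ : Fin n → ℂ) : Fin n → ℂ :=
  fun j =>
    if (j : ℕ) < n - 1 then ζ j * (2 * r * Complex.I / (Complex.I + ζ (lastIdx n hn)))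
    else r * (Complex.I - ζ (lastIdx n hn)) / (Complex.I + ζ (lastIdx n hn))

theorem cayleyInv_lastIdx :
    cayleyInv n hn r z (lastIdx n hn) =
      r * (Complex.I - z (lastIdx n hn)) / (Complex.I + z (lastIdx n hn)) := by
  simp [cayleyInv, lastIdx]

theorem I_add_cayley_lastIdx (hz : z (lastIdx n hn) ≠ -(r : ℂ)) :
    Complex.I + cayley n hn r z (lastIdx n hn) =
      2 * r * Complex.I / (r + z (lastIdx n hn)) := by
  have h := add_ne_zero_of_ne_neg hz
  rw [cayley_lastIdx]
  field_simp
  ring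

theorem add_cayleyInv_lastIdx (hz : z (lastIdx n hn) ≠ -Complex.I) :
    r + cayleyInv n hn r z (lastIdx n hn) =
      2 * r * Complex.I / (Complex.I + z (lastIdx n hn)) := by
  have h := add_ne_zero_of_ne_neg hz
  rw [cayleyInv_lastIdx]
  field_simp
  ring

theorem cayley_lastIdx_ne (hr : r ≠ 0) (hz : z (lastIdx n hn) ≠ -(r : ℂ)) :
    cayley n hn r z (lastIdx n hn) ≠ -Complex.I := by
  intro h
  have h1 := I_add_cayley_lastIdx hz
  rw [h, add_neg_cancel] at h1
  have h2 := add_ne_zero_of_ne_neg hz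
  have : 2 * (r : ℂ) * Complex.I / (r + z (lastIdx n hn)) ≠ 0 := by simp [hr, h2]
  exact this h1.symm

theorem cayleyInv_lastIdx_ne (hr : r ≠ 0) (hz : z (lastIdx n hn) ≠ -Complex.I) :
    cayleyInv n hn r z (lastIdx n hn) ≠ -(r : ℂ) := by
  intro h
  have h1 := add_cayleyInv_lastIdx (r := r) hz
  rw [h, add_neg_cancel] at h1
  have h2 := add_ne_zero_of_ne_neg hz
  have : 2 * (r : ℂ) * Complex.I / (Complex.I + z (lastIdx n hn)) ≠ 0 := by simp [hr, h2]
  exact this h1.symm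

theorem cayleyInv_cayley (hr : r ≠ 0) (hz : z (lastIdx n hn) ≠ -(r : ℂ)) :
    cayleyInv n hn r (cayley n hn r z) = z := by
  have h := add_ne_zero_of_ne_neg hz
  have hrC : (r : ℂ) ≠ 0 := by exact_mod_cast hr
  funext j
  by_cases hj : (j : ℕ) < n - 1
  · simp only [cayleyInv, hj, if_true]
    rw [I_add_cayley_lastIdx hz, cayley_of_lt hj]
    field_simp
  · rw [eq_lastIdx_of_not_lt hn hj, cayleyInv_lastIdx, I_add_cayley_lastIdx hz, cayley_lastIdx]
    field_simp
    ring

theorem cayley_cayleyInv (hr : r ≠ 0) (hz : z (lastIdx n hn) ≠ -Complex.I) :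
    cayley n hn r (cayleyInv n hn r z) = z := by
  have h := add_ne_zero_of_ne_neg hz
  have hrC : (r : ℂ) ≠ 0 := by exact_mod_cast hr
  funext j
  by_cases hj : (j : ℕ) < n - 1
  · rw [cayley_of_lt hj, add_cayleyInv_lastIdx hz]
    simp only [cayleyInv, hj, if_true]
    field_simp
  · rw [eq_lastIdx_of_not_lt hn hj, cayley_lastIdx, add_cayleyInv_lastIdx hz, cayleyInv_lastIdx]
    field_simp
    ring

theorem im_I_mul_sub_div_add (r : ℝ) (w : ℂ) :
    (Complex.I * ((r : ℂ) - w) / ((r : ℂ) + w)).im =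
      (r ^ 2 - Complex.normSq w) / Complex.normSq ((r : ℂ) + w) := by
  rw [Complex.div_im]
  simp [Complex.normSq_apply]
  ring

theorem sum_eps_mul_normSq {s : ℕ} (hn : 0 < n) (hsn : s < n) (z : Fin n → ℂ) :
    ∑ j : Fin n, eps s j * Complex.normSq (z j) =
      (∑ j : Fin n, if (j : ℕ) < n - 1 then eps s j * Complex.normSq (z j) else 0) +
        Complex.normSq (z (lastIdx n hn)) := by
  have hlast : ∀ j : Fin n, ¬ (j : ℕ) < n - 1 ↔ j = lastIdx n hn := fun j =>
    ⟨eq_lastIdx_of_not_lt hn, by rintro rfl; simp [lastIdx]⟩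
  have heps : eps s (lastIdx n hn) = 1 :=
    if_neg (show ¬ n - 1 < s by omega)
  have h1 : Complex.normSq (z (lastIdx n hn)) =
      ∑ j : Fin n, if j = lastIdx n hn then eps s j * Complex.normSq (z j) else 0 := by
    simp [heps]
  rw [h1, ← Finset.sum_add_distrib]
  refine Finset.sum_congr rfl fun j _ => ?_
  by_cases hj : (j : ℕ) < n - 1
  · have : j ≠ lastIdx n hn := fun h => (hlast j).2 h hj
    simp [hj, this]
  · rw [if_neg hj, if_pos ((hlast j).1 hj), zero_add]

theorem mem_pseudosphere_iff_cayley {s : ℕ} (hsn : s < n) (hz : z (lastIdx n hn) ≠ -(r : ℂ)) :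
    ∑ j : Fin n, eps s j * Complex.normSq (z j) = r ^ 2 ↔
      (cayley n hn r z (lastIdx n hn)).im =
        ∑ j : Fin n, if (j : ℕ) < n - 1 then
          eps s j * Complex.normSq (cayley n hn r z j) else 0 := by
  have hD : Complex.normSq ((r : ℂ) + z (lastIdx n hn)) ≠ 0 := by
    simpa [Complex.normSq_eq_zero] using add_ne_zero_of_ne_neg hz
  have hsum : (∑ j : Fin n, if (j : ℕ) < n - 1 then
          eps s j * Complex.normSq (cayley n hn r z j) else 0) =
      (∑ j : Fin n, if (j : ℕ) < n - 1 then eps s j * Complex.normSq (z j) else 0) /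
        Complex.normSq ((r : ℂ) + z (lastIdx n hn)) := by
    rw [Finset.sum_div]
    refine Finset.sum_congr rfl fun j _ => ?_
    split_ifs with hj
    · rw [cayley_of_lt hj, Complex.normSq_div, mul_div_assoc]
    · simp
  rw [hsum, cayley_lastIdx, im_I_mul_sub_div_add, div_left_inj' hD, sum_eps_mul_normSq hn hsn,
    sub_eq_iff_eq_add, eq_comm]

end Cayley

/-- the Cayley transform is a bijection from the punctured pseudosphere
`{∑ ε_j |z_j|² = r², z_n ≠ -r}` onto
`∂𝒮_{s,n} \ {ζ_n = -i} = {Im(ζ_n) = ∑_{α<n} ε_α |ζ_α|², ζ_n ≠ -i}`. -/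
theorem stmt_14 (n s : ℕ) (hn : 2 ≤ n) (hs : 0 < s) (hsn : s < n) (r : ℝ) (hr : 0 < r) :
    Set.BijOn (cayley n (by omega) r)
      {z : Fin n → ℂ | ∑ j : Fin n, eps s j * Complex.normSq (z j) = r ^ 2 ∧
        z (lastIdx n (by omega)) ≠ -(r : ℂ)}
      {ζ : Fin n → ℂ | (ζ (lastIdx n (by omega))).im =
          (∑ j : Fin n, if (j : ℕ) < n - 1 then eps s j * Complex.normSq (ζ j) else 0) ∧
        ζ (lastIdx n (by omega)) ≠ -Complex.I} := by
  refine ⟨fun z hz => ⟨?_, cayley_lastIdx_ne hr.ne' hz.2⟩, fun z hz w hw h => ?_,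
    fun ζ hζ => ⟨cayleyInv n (by omega) r ζ, ⟨?_, cayleyInv_lastIdx_ne hr.ne' hζ.2⟩,
      cayley_cayleyInv hr.ne' hζ.2⟩⟩
  · exact (mem_pseudosphere_iff_cayley hsn hz.2).1 hz.1
  · rw [← cayleyInv_cayley hr.ne' hz.2, h, cayleyInv_cayley hr.ne' hw.2]
  · rw [mem_pseudosphere_iff_cayley hsn (cayleyInv_lastIdx_ne hr.ne' hζ.2),
      cayley_cayleyInv hr.ne' hζ.2]
    exact hζ.1
end

section
/- Let n ≥ 1, 0 ≤ s < n, and set ε_j = -1 for 1 ≤ j ≤ s and ε_j = +1 for s+1 ≤ j ≤ n. For w ∈ ℂ with Im(w) > 0, u ∈ ℂ and v ∈ ℂⁿ, define Q(w; u, v) = Im(w)^{-2}·|u|² + Im(w)·∑_{j=1}^n ε_j|v_j|² (the squared length of the tangent vector (u,v) at (w,z) ∈ ℂ₊ × ℂⁿ_s in the indefinite Hermitian metric g_{s,n} = Im(w)^{-2} dw ⊙ dw̄ + Im(w)·∑_j ε_j dz^j ⊙ dz̄^j). Let α ∈ ℝ with α > 0 and β ∈ ℂ with α·|β|² = 1.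 Then Im(α·w) > 0 and Q(α·w; α·u, β·v) = Q(w; u, v); consequently g_{s,n} is invariant under the holomorphic transformation F₀(w,z) = (α·w, β·z) of ℂ₊ × ℂⁿ and under the group G_{α,β} generated by F₀. (Such α > 1 and β ∈ ℂ \ ℝ with α·β·β̄ = det(a) = 1 arise as the spectrum of a unimodular matrix a ∈ SL(3,ℤ).) -/
/-- The squared length `Q(w; u, v) = Im(w)^{-2}|u|² + Im(w)·∑_j ε_j|v_j|²` of the tangent
vector `(u, v)` at a point `(w, z) ∈ ℂ₊ × ℂⁿ_s` in the indefinite Hermitian metric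
`g_{s,n} = Im(w)^{-2} dw ⊙ dw̄ + Im(w)·∑_j ε_j dz^j ⊙ dz̄^j`. -/
noncomputable def Qlen (n s : ℕ) (w u : ℂ) (v : Fin n → ℂ) : ℝ :=
  (w.im ^ 2)⁻¹ * Complex.normSq u +
    w.im * ∑ j : Fin n, (if (j : ℕ) < s then (-1 : ℝ) else 1) * Complex.normSq (v j)

theorem Qlen_ofReal_mul (n s : ℕ) {α : ℝ} (hα : 0 < α) {β : ℂ}
    (hαβ : α * Complex.normSq β = 1) (w u : ℂ) (v : Fin n → ℂ) :
    Qlen n s ((α : ℂ) * w) ((α : ℂ) * u) (fun j => β * v j) = Qlen n s w u v := by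
  have hbase : ((α * w.im) ^ 2)⁻¹ * (α * α * Complex.normSq u) =
      (w.im ^ 2)⁻¹ * Complex.normSq u := by
    rw [mul_pow, mul_inv]
    field_simp
  have hsum : ∑ j : Fin n, (if (j : ℕ) < s then (-1 : ℝ) else 1) *
        (Complex.normSq β * Complex.normSq (v j)) =
      Complex.normSq β *
        ∑ j : Fin n, (if (j : ℕ) < s then (-1 : ℝ) else 1) * Complex.normSq (v j) := by
    rw [Finset.mul_sum]
    exact Finset.sum_congr rfl fun j _ => mul_left_comm _ _ _
  simp only [Qlen, Complex.im_ofReal_mul, Complex.normSq_mul, Complex.normSq_ofReal]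
  rw [hbase, hsum, mul_comm α w.im, mul_assoc, ← mul_assoc α, hαβ, one_mul]

/-- for `α > 0` real and `β ∈ ℂ` with `α·|β|² = 1`, one has `Im(α·w) > 0`
whenever `Im(w) > 0`, and `Q(α·w; α·u, β·v) = Q(w; u, v)`; consequently the metric
`g_{s,n}` is invariant under the holomorphic transformation `F₀(w,z) = (α·w, β·z)` and
under the whole group `G_{α,β}` generated by `F₀`. -/
theorem stmt_15 (n s : ℕ) (hn : 1 ≤ n) (hsn : s < n)
    (α : ℝ) (hα : 0 < α) (β : ℂ) (hαβ : α * Complex.normSq β = 1) :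
    ∀ w : ℂ, 0 < w.im →
      (0 < ((α : ℂ) * w).im ∧
        ∀ (u : ℂ) (v : Fin n → ℂ),
          Qlen n s ((α : ℂ) * w) ((α : ℂ) * u) (fun j => β * v j) = Qlen n s w u v) ∧
      (∀ m : ℤ, 0 < (((α : ℂ) ^ m) * w).im ∧
        ∀ (u : ℂ) (v : Fin n → ℂ),
          Qlen n s (((α : ℂ) ^ m) * w) (((α : ℂ) ^ m) * u) (fun j => β ^ m * v j) =
            Qlen n s w u v) := by
  intro w hw
  have him : ∀ a : ℝ, 0 < a → 0 < ((a : ℂ) * w).im := fun a ha => by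
    rw [Complex.im_ofReal_mul]
    exact mul_pos ha hw
  refine ⟨⟨him α hα, Qlen_ofReal_mul n s hα hαβ w⟩, fun m => ?_⟩
  have hm : α ^ m * Complex.normSq (β ^ m) = 1 := by
    rw [map_zpow₀, ← mul_zpow, hαβ, one_zpow]
  have hαm : 0 < α ^ m := zpow_pos hα m
  rw [← Complex.ofReal_zpow]
  exact ⟨him _ hαm, Qlen_ofReal_mul n s hαm hm w⟩
end
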